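/- For every k ∈ ℕ there exists a game space (X,d) whose underlying topological space is homeomorphic to the 3-sphere 𝕊³ = {x ∈ ℝ⁴ : |x| = 1} and whose cop number satisfies c(X) > k. Moreover, the robber has a strategy against k cops on X that uses a constant agility function and guarantees inf_n min_{i≤k} d(r^n, c^n_i) > 0 against every cop play. -/

import Mathlib

/-!
Game of Cops and Robber on metric spaces, following Mohar, formalized relative to an
explicit distance function `d : Y → Y → ℝ`.
-/

open Set Filter Topology

/-- The length of (the restriction to `[0,1]` of) a map `p : ℝ → Y` with respect to an
extended-real-valued cost function `c`, defined as the supremum over all finite monotone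
partitions of `[0,1]` of the sums of the costs of consecutive points. -/
noncomputable def elen {Y : Type*} (c : Y → Y → ENNReal) (p : ℝ → Y) : ENNReal :=
  ⨆ q : ℕ × {u : ℕ → ℝ // Monotone u ∧ ∀ i, u i ∈ Set.Icc (0 : ℝ) 1},
    ∑ i ∈ Finset.range q.1, c (p (q.2.1 i)) (p (q.2.1 (i + 1)))

/-- Continuity on `[0,1]` of a map `p : ℝ → Y` with respect to a cost function `c`,
stated in `ε`-`δ` form. -/
def econt {Y : Type*} (c : Y → Y → ENNReal) (p : ℝ → Y) : Prop :=
  ∀ t ∈ Set.Icc (0 : ℝ) 1, ∀ ε : ENNReal, 0 < ε →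
    ∃ δ : ℝ, 0 < δ ∧ ∀ t' ∈ Set.Icc (0 : ℝ) 1, |t' - t| < δ → c (p t) (p t') < ε

/-- `d` is a metric on `Y`. -/
def IsMetricD (Y : Type*) (d : Y → Y → ℝ) : Prop :=
  (∀ x, d x x = 0) ∧ (∀ x y, d x y = 0 → x = y) ∧
    (∀ x y, d x y = d y x) ∧ (∀ x y z, d x z ≤ d x y + d y z)

/-- Compactness of the metric space `(Y,d)`, in its sequential form: every sequence has a
convergent subsequence. -/
def CompactD (Y : Type*) (d : Y → Y → ℝ) : Prop :=
  ∀ u : ℕ → Y, ∃ (x : Y) (φ : ℕ → ℕ), StrictMono φ ∧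
    Filter.Tendsto (fun n => d (u (φ n)) x) Filter.atTop (nhds 0)

/-- `(Y,d)` is a geodesic metric space: any two points `x, y` are joined by a continuous
path `p : [0,1] → Y` whose length equals `d x y`. -/
def IsGeodesicD (Y : Type*) (d : Y → Y → ℝ) : Prop :=
  ∀ x y : Y, ∃ p : ℝ → Y,
    econt (fun a b => ENNReal.ofReal (d a b)) p ∧ p 0 = x ∧ p 1 = y ∧
      elen (fun a b => ENNReal.ofReal (d a b)) p = ENNReal.ofReal (d x y)

/-- A game space is a (nonempty) compact geodesic metric space. -/
def GameSpaceD (Y : Type*) (d : Y → Y → ℝ) : Prop :=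
  Nonempty Y ∧ IsMetricD Y d ∧ CompactD Y d ∧ IsGeodesicD Y d

/-- An agility function: positive, with divergent sum. -/
def IsAgility (τ : ℕ → ℝ) : Prop := (∀ n, 0 < τ n) ∧ ¬ Summable τ

/-- The trajectory of the `k` cops determined by initial positions `c0`, a cop strategy `σ`
(where `σ n` computes the cops' positions at step `n+1` from the robber's positions
`r^0, …, r^(n+1)`), and a robber trajectory `r`. -/
def copTraj {Y : Type*} {k : ℕ} (c0 : Fin k → Y)
    (σ : (n : ℕ) → (Fin (n + 2) → Y) → Fin k → Y) (r : ℕ → Y) : ℕ → Fin k → Y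
  | 0 => c0
  | n + 1 => σ n fun i => r i

/-- The trajectory of the robber determined by his initial position `r0`, a robber strategy
`ρ` (where `ρ n` computes the robber's position at step `n+1` from the cops' positions
`c^0, …, c^n`), and a cop trajectory `c`. -/
def robTraj {Y : Type*} {k : ℕ} (r0 : Y)
    (ρ : (n : ℕ) → (Fin (n + 1) → Fin k → Y) → Y) (c : ℕ → Fin k → Y) : ℕ → Y
  | 0 => r0
  | n + 1 => ρ n fun i => c i

/-- `k` cops have a winning strategy on `(Y,d)`: for every agility function and every initial
position chosen by the robber there is a cop strategy `σ`, assigning legal cop moves to every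
history, such that against every legal robber trajectory the cops come arbitrarily close to
the robber. -/
def CopsWinWith (Y : Type*) (d : Y → Y → ℝ) (k : ℕ) : Prop :=
  ∀ τ : ℕ → ℝ, IsAgility τ → ∀ r0 : Y, ∀ c0 : Fin k → Y,
    ∃ σ : (n : ℕ) → (Fin (n + 2) → Y) → Fin k → Y,
      ∀ r : ℕ → Y, r 0 = r0 → (∀ n, d (r n) (r (n + 1)) ≤ τ (n + 1)) →
        (∀ n i, d (copTraj c0 σ r n i) (copTraj c0 σ r (n + 1) i) ≤ τ (n + 1)) ∧
          (∀ ε : ℝ, 0 < ε → ∃ n i, d (r n) (copTraj c0 σ r n i) < ε)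

/-- The cop number of `(Y,d)`, as an extended natural number: the least `k` such that `k`
cops have a winning strategy (`⊤` if there is no such `k`). -/
noncomputable def copNumber (Y : Type*) (d : Y → Y → ℝ) : ℕ∞ :=
  sInf {m : ℕ∞ | ∃ k : ℕ, m = (k : ℕ∞) ∧ CopsWinWith Y d k}

/-- The robber has a strategy against `k` cops on `(Y,d)` with agility function `τ` which
guarantees that his moves are legal and that every cop always stays at distance `> ε` from
him, against every legal cop play. -/
def RobberWins (Y : Type*) (d : Y → Y → ℝ) (k : ℕ) (τ : ℕ → ℝ) (ε : ℝ) : Prop :=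
  ∃ (r0 : Y) (c0 : Fin k → Y) (ρ : (n : ℕ) → (Fin (n + 1) → Fin k → Y) → Y),
    ∀ c : ℕ → Fin k → Y, c 0 = c0 → (∀ n i, d (c n i) (c (n + 1) i) ≤ τ (n + 1)) →
      (∀ n, d (robTraj r0 ρ c n) (robTraj r0 ρ c (n + 1)) ≤ τ (n + 1)) ∧
        (∀ n i, ε < d (robTraj r0 ρ c n) (c n i))

/-- A map `ℝ → Y` that does not increase distances. -/
def IsShort {Y : Type*} [PseudoMetricSpace Y] (p : ℝ → Y) : Prop :=
  ∀ s t, dist (p s) (p t) ≤ |s - t|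

/-- The points `x` and `y` are joined by a distance-nonincreasing path parametrized by `[0, L]`. -/
def JoinedWithin {Y : Type*} [PseudoMetricSpace Y] (x y : Y) (L : ℝ) : Prop :=
  ∃ p : ℝ → Y, IsShort p ∧ p 0 = x ∧ p L = y

namespace JoinedWithin

variable {Y : Type*} [PseudoMetricSpace Y] {x y z : Y} {L L' : ℝ}

theorem refl (x : Y) : JoinedWithin x x 0 :=
  ⟨fun _ => x, fun s t => by simp, rfl, rfl⟩

theorem symm (h : JoinedWithin x y L) : JoinedWithin y x L := by
  obtain ⟨p, hp, h0, h1⟩ := h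
  refine ⟨fun s => p (L - s), fun s t => ?_, by simpa, by simpa⟩
  refine (hp _ _).trans_eq ?_
  rw [abs_sub_comm s t]
  congr 1
  ring

theorem trans (hL : 0 ≤ L) (hL' : 0 ≤ L') (h : JoinedWithin x y L) (h' : JoinedWithin y z L') :
    JoinedWithin x z (L + L') := by
  obtain ⟨p, hp, h0, h1⟩ := h
  obtain ⟨q, hq, h0', h1'⟩ := h'
  have cross : ∀ s t, s ≤ L → L < t → dist (p s) (q (t - L)) ≤ |s - t| := fun s t hs ht => by
    have e1 := hp s L
    have e2 := hq 0 (t - L)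
    rw [h0', ← h1] at e2
    rw [abs_sub_comm, abs_of_nonneg (by linarith)] at e1 e2 ⊢
    linarith [dist_triangle (p s) (p L) (q (t - L))]
  refine ⟨fun s => if s ≤ L then p s else q (s - L), fun s t => ?_, by simp [hL, h0], ?_⟩
  · by_cases hs : s ≤ L <;> by_cases ht : t ≤ L
    · simpa [hs, ht] using hp s t
    · simpa [hs, ht] using cross s t hs (not_le.1 ht)
    · have := cross t s ht (not_le.1 hs)
      rw [dist_comm, abs_sub_comm] at this
      simpa [hs, ht] using this
    · simpa [hs, ht] using hq (s - L) (t - L)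
  · rcases hL'.eq_or_lt with rfl | h
    · simp [h1, ← h1', h0']
    · simp [not_le.2 h, h1']

theorem dist_le (hL : 0 ≤ L) (h : JoinedWithin x y L) : dist x y ≤ L := by
  obtain ⟨p, hp, h0, h1⟩ := h
  have := hp 0 L
  rwa [h0, h1, zero_sub, abs_neg, abs_of_nonneg hL] at this

theorem of_isShort {p : ℝ → Y} (hp : IsShort p) (s t : ℝ) : JoinedWithin (p s) (p t) |s - t| := by
  rcases le_total s t with h | h
  · refine ⟨fun u => p (s + u), fun u v => (hp _ _).trans_eq (by congr 1; ring), by simp, ?_⟩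
    rw [abs_sub_comm, abs_of_nonneg (sub_nonneg.2 h)]
    simp
  · refine ⟨fun u => p (s - u), fun u v => (hp _ _).trans_eq ?_, by simp, ?_⟩
    · rw [abs_sub_comm u v]
      congr 1
      ring
    · rw [abs_of_nonneg (sub_nonneg.2 h)]
      simp

end JoinedWithin

/-- The intrinsic distance: the infimum of the lengths of paths joining two points. -/
noncomputable def intrinsicDist {Y : Type*} [PseudoMetricSpace Y] (x y : Y) : ℝ :=
  sInf {L : ℝ | 0 ≤ L ∧ JoinedWithin x y L}

section Intrinsic

variable {Y : Type*} [PseudoMetricSpace Y]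

theorem intrinsicDist_nonneg (x y : Y) : 0 ≤ intrinsicDist x y :=
  Real.sInf_nonneg fun _ h => h.1

theorem intrinsicDist_le {x y : Y} {L : ℝ} (hL : 0 ≤ L) (h : JoinedWithin x y L) :
    intrinsicDist x y ≤ L :=
  csInf_le ⟨0, fun _ h => h.1⟩ ⟨hL, h⟩

theorem isClosed_setOf_isShort : IsClosed {p : ℝ → Y | IsShort p} := by
  have : {p : ℝ → Y | IsShort p} = ⋂ s, ⋂ t, {p : ℝ → Y | dist (p s) (p t) ≤ |s - t|} := by
    ext p
    simp [IsShort]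
  rw [this]
  exact isClosed_iInter fun s => isClosed_iInter fun t =>
    isClosed_le ((continuous_apply s).dist (continuous_apply t)) continuous_const

/-- In a compact space, the infimum defining the intrinsic distance is attained. -/
theorem joinedWithin_intrinsicDist {Y : Type*} [MetricSpace Y] [CompactSpace Y] {x y : Y}
    (h : ∃ L, 0 ≤ L ∧ JoinedWithin x y L) : JoinedWithin x y (intrinsicDist x y) := by
  set D := intrinsicDist x y with hD
  let C : ℕ → Set (ℝ → Y) := fun n =>
    {p | IsShort p} ∩ ({p | p 0 = x} ∩ {p | dist (p D) y ≤ 1 / ((n : ℝ) + 1)})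
  have hclosed : ∀ n, IsClosed (C n) := fun n => by
    refine isClosed_setOf_isShort.inter (IsClosed.inter ?_ ?_)
    · exact isClosed_eq (continuous_apply 0) continuous_const
    · exact isClosed_le ((continuous_apply D).dist continuous_const) continuous_const
  have hne : ∀ n, (C n).Nonempty := fun n => by
    obtain ⟨L, ⟨hL0, p, hp, h0, h1⟩, hL⟩ :=
      exists_lt_of_csInf_lt (s := {L : ℝ | 0 ≤ L ∧ JoinedWithin x y L}) h
        (show D < D + 1 / ((n : ℝ) + 1) by linarith [Nat.one_div_pos_of_nat (α := ℝ) (n := n)])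
    refine ⟨p, hp, h0, ?_⟩
    have hDL : D ≤ L := intrinsicDist_le hL0 ⟨p, hp, h0, h1⟩
    rw [← h1]
    refine (hp _ _).trans ?_
    rw [abs_sub_comm, abs_of_nonneg (by linarith)]
    linarith
  obtain ⟨p, hp⟩ := IsCompact.nonempty_iInter_of_sequence_nonempty_isCompact_isClosed C
    (fun n p hp => ⟨hp.1, hp.2.1,
      (show dist (p D) y ≤ _ from hp.2.2).trans (Nat.one_div_le_one_div n.le_succ)⟩)
    hne (hclosed 0).isCompact hclosed
  rw [Set.mem_iInter] at hp
  refine ⟨p, (hp 0).1, (hp 0).2.1, dist_le_zero.1 ?_⟩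
  exact ge_of_tendsto' tendsto_one_div_add_atTop_nhds_zero_nat fun n => (hp n).2.2

end Intrinsic

/-- A copy of `Y`, to be equipped with the intrinsic distance. -/
structure Intrinsic (Y : Type) where
  /-- The underlying point. -/
  val : Y

/-- A compact metric space in which nearby points are joined by short paths is homeomorphic to
a geodesic space whose distance dominates the given one and for which distance-nonincreasing
paths stay distance-nonincreasing. -/
theorem exists_intrinsic_metricSpace (Y : Type) [MetricSpace Y] [CompactSpace Y] (g : Y → Y → ℝ)
    (hg0 : ∀ x y, 0 ≤ g x y) (hgt : ∀ x, Tendsto (g x) (𝓝 x) (𝓝 0))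
    (hg : ∀ x y, JoinedWithin x y (g x y)) :
    ∃ (X : Type) (_ : MetricSpace X) (e : X ≃ₜ Y),
      (∀ x y, dist (e x) (e y) ≤ dist x y) ∧
      (∀ p : ℝ → Y, IsShort p → IsShort (e.symm ∘ p)) ∧
      ∀ x y : X, ∃ p : ℝ → X, IsShort p ∧ p 0 = x ∧ p (dist x y) = y := by
  have att : ∀ x y : Y, JoinedWithin x y (intrinsicDist x y) := fun x y =>
    joinedWithin_intrinsicDist ⟨_, hg0 x y, hg x y⟩
  have nn := intrinsicDist_nonneg (Y := Y)
  have le : ∀ x y : Y, dist x y ≤ intrinsicDist x y := fun x y => (att x y).dist_le (nn x y)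
  have self : ∀ x : Y, intrinsicDist x x = 0 := fun x =>
    (intrinsicDist_le le_rfl (.refl x)).antisymm (nn x x)
  let m : MetricSpace (Intrinsic Y) :=
    { dist := fun x y => intrinsicDist x.val y.val
      dist_self := fun x => self _
      dist_comm := fun x y => (intrinsicDist_le (nn _ _) (att _ _).symm).antisymm
        (intrinsicDist_le (nn _ _) (att _ _).symm)
      dist_triangle := fun x y z => intrinsicDist_le (add_nonneg (nn _ _) (nn _ _))
        ((att _ _).trans (nn _ _) (nn _ _) (att _ _))
      eq_of_dist_eq_zero := fun {x y} h =>
        congrArg Intrinsic.mk (dist_le_zero.1 ((le x.val y.val).trans_eq h)) }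
  have short : ∀ p : ℝ → Y, IsShort p → IsShort fun s => Intrinsic.mk (p s) := fun p hp s t =>
    intrinsicDist_le (abs_nonneg _) (.of_isShort hp s t)
  let e : Intrinsic Y ≃ₜ Y :=
    { toFun := Intrinsic.val
      invFun := Intrinsic.mk
      left_inv := fun _ => rfl
      right_inv := fun _ => rfl
      continuous_toFun := (LipschitzWith.mk_one fun x y => le x.val y.val).continuous
      continuous_invFun := continuous_iff_continuousAt.2 fun x => by
        refine tendsto_iff_dist_tendsto_zero.2 (squeeze_zero (fun _ => dist_nonneg) ?_ (hgt x))
        intro y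
        rw [dist_comm]
        exact intrinsicDist_le (hg0 x y) (hg x y) }
  refine ⟨Intrinsic Y, m, e, fun x y => le x.val y.val, short, fun x y => ?_⟩
  obtain ⟨p, hp, h0, h1⟩ := att x.val y.val
  exact ⟨fun s => ⟨p s⟩, short p hp, congrArg Intrinsic.mk h0, congrArg Intrinsic.mk h1⟩

/-- A compact metric space whose points are joined by distance-nonincreasing paths parametrized
by their distance is a game space. -/
theorem gameSpaceD_of_short_paths {X : Type*} [MetricSpace X] [CompactSpace X] [Nonempty X]
    (h : ∀ x y : X, ∃ p : ℝ → X, IsShort p ∧ p 0 = x ∧ p (dist x y) = y) :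
    GameSpaceD X fun x y => dist x y := by
  refine ⟨‹_›, ⟨dist_self, fun _ _ => eq_of_dist_eq_zero, dist_comm, dist_triangle⟩,
    fun u => ?_, fun x y => ?_⟩
  · obtain ⟨x, φ, hφ, hx⟩ := CompactSpace.tendsto_subseq u
    exact ⟨x, φ, hφ, tendsto_iff_dist_tendsto_zero.1 hx⟩
  obtain ⟨p, hp, h0, h1⟩ := h x y
  have hp' : ∀ s t : ℝ, dist (p (dist x y * s)) (p (dist x y * t)) ≤ dist x y * |s - t| :=
    fun s t => (hp _ _).trans_eq (by rw [← mul_sub, abs_mul, abs_of_nonneg dist_nonneg])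
  refine ⟨fun s => p (dist x y * s), fun t _ ε hε => ?_, by simpa, by simpa, le_antisymm ?_ ?_⟩
  · obtain ⟨δ, hδ, h⟩ := ENNReal.lt_iff_exists_real_btwn.1 hε
    have hδ' : 0 < δ := by simpa using h.1
    have hd : 0 < dist x y + 1 := by positivity
    refine ⟨δ / (dist x y + 1), by positivity, fun t' _ ht' => ?_⟩
    refine lt_of_le_of_lt (ENNReal.ofReal_le_ofReal ((hp' t t').trans ?_)) h.2
    rw [abs_sub_comm]
    rw [lt_div_iff₀ hd] at ht'
    nlinarith [abs_nonneg (t' - t)]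
  · refine iSup_le fun ⟨n, u, hu, hI⟩ => ?_
    rw [← ENNReal.ofReal_sum_of_nonneg fun _ _ => dist_nonneg]
    refine ENNReal.ofReal_le_ofReal ?_
    calc ∑ i ∈ Finset.range n, dist (p (dist x y * u i)) (p (dist x y * u (i + 1)))
        ≤ ∑ i ∈ Finset.range n, dist x y * (u (i + 1) - u i) :=
          Finset.sum_le_sum fun i _ => (hp' _ _).trans_eq (by
            rw [abs_sub_comm, abs_of_nonneg (sub_nonneg.2 (hu i.le_succ))])
      _ = dist x y * (u n - u 0) := by rw [← Finset.mul_sum, Finset.sum_range_sub]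
      _ ≤ dist x y := by
          have := (hI n).2
          have := (hI 0).1
          exact mul_le_of_le_one_right dist_nonneg (by linarith)
  · refine le_iSup_of_le ⟨1, fun i => if i = 0 then 0 else 1, fun i j hij => ?_, fun i => ?_⟩ ?_
    · by_cases hi : i = 0
      · by_cases hj : j = 0 <;> simp [hi, hj]
      · simp [hi, show j ≠ 0 by omega]
    · by_cases hi : i = 0 <;> simp [hi]
    · simp [h0, h1]

/-- Data for an escape strategy of a robber who walks on a family of points `pt`: at the point
`v` he may move to the points `nb v i`, and the function `f v` bounds from below the distance
to `pt v` in such a way that a single position within reach of two of the points `nb v i`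
is already close to `v`. -/
structure EscapeData (X : Type*) [MetricSpace X] (V : Type*) (k : ℕ) (t ε : ℝ) where
  /-- The points visited by the robber. -/
  pt : V → X
  /-- The lower bounds for the distances to these points. -/
  f : V → X → ℝ
  /-- The possible moves. -/
  nb : V → Fin (k + 1) → V
  f_pt : ∀ v, f v (pt v) = 0
  f_le : ∀ v x y, f v x ≤ f v y + dist x y
  dist_nb : ∀ v i, dist (pt v) (pt (nb v i)) ≤ t
  close : ∀ v x i j, i ≠ j → f (nb v i) x ≤ t + ε → f (nb v j) x ≤ t + ε → f v x ≤ ε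

namespace EscapeData

variable {X V : Type*} [MetricSpace X] {k : ℕ} {t ε : ℝ} (D : EscapeData X V k t ε)

theorem exists_nb (v : V) (c : Fin k → X) (hc : ∀ i, ε < D.f v (c i)) :
    ∃ j, ∀ i, t + ε < D.f (D.nb v j) (c i) := by
  by_contra! h
  choose b hb using h
  obtain ⟨j, j', hne, hjj'⟩ := Fintype.exists_ne_map_eq_of_card_lt b (by simp)
  have := D.close v (c (b j)) j j' hne (hb j) (hjj' ▸ hb j')
  linarith [hc (b j)]

open Classical in
/-- The robber's next vertex. -/
noncomputable def next (v : V) (c : Fin k → X) : V :=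
  if h : ∃ j, ∀ i, t + ε < D.f (D.nb v j) (c i) then D.nb v h.choose else D.nb v 0

theorem dist_next (v : V) (c : Fin k → X) : dist (D.pt v) (D.pt (D.next v c)) ≤ t := by
  unfold next
  split_ifs <;> exact D.dist_nb _ _

theorem lt_next (v : V) (c : Fin k → X) (hc : ∀ i, ε < D.f v (c i)) (i : Fin k) :
    t + ε < D.f (D.next v c) (c i) := by
  have h := D.exists_nb v c hc
  rw [next, dif_pos h]
  exact h.choose_spec i

/-- The robber's vertex at each step, given the trajectory of the cops. -/
noncomputable def vert (v0 : V) (c : ℕ → Fin k → X) : ℕ → V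
  | 0 => v0
  | n + 1 => D.next (vert v0 c n) (c n)

theorem vert_congr (v0 : V) {c c' : ℕ → Fin k → X} {n : ℕ} (h : ∀ m < n, c m = c' m) :
    D.vert v0 c n = D.vert v0 c' n := by
  induction n with
  | zero => rfl
  | succ n ih => rw [vert, vert, ih fun m hm => h m (by omega), h n n.lt_succ_self]

theorem dist_vert (v0 : V) (c : ℕ → Fin k → X) (n : ℕ) :
    dist (D.pt (D.vert v0 c n)) (D.pt (D.vert v0 c (n + 1))) ≤ t :=
  D.dist_next _ _

theorem lt_dist_vert (v0 : V) (c : ℕ → Fin k → X) (h0 : ∀ i, ε < D.f v0 (c 0 i))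
    (hc : ∀ n i, dist (c n i) (c (n + 1) i) ≤ t) (n : ℕ) (i : Fin k) :
    ε < dist (D.pt (D.vert v0 c n)) (c n i) := by
  have key : ∀ n i, ε < D.f (D.vert v0 c n) (c n i) := by
    intro n
    induction n with
    | zero => exact h0
    | succ n ih =>
      intro i
      have h1 := D.lt_next (D.vert v0 c n) (c n) ih i
      have h2 := D.f_le (D.vert v0 c (n + 1)) (c n i) (c (n + 1) i)
      rw [vert] at h2 ⊢
      linarith [hc n i]
  have h1 := key n i
  have h2 := D.f_le (D.vert v0 c n) (c n i) (D.pt (D.vert v0 c n))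
  rw [D.f_pt, zero_add, dist_comm] at h2
  linarith

/-- The robber wins against `k` cops. -/
theorem robberWins (v0 : V) (x0 : X) (h0 : ε < D.f v0 x0) :
    RobberWins X (fun x y => dist x y) k (fun _ => t) ε := by
  refine ⟨D.pt v0, fun _ => x0, fun n h => D.pt (D.vert v0
    (fun m => if hm : m < n + 1 then h ⟨m, hm⟩ else fun _ => x0) (n + 1)), fun c hc0 hc => ?_⟩
  have hr : ∀ n, robTraj (D.pt v0) (fun n h => D.pt (D.vert v0
      (fun m => if hm : m < n + 1 then h ⟨m, hm⟩ else fun _ => x0) (n + 1))) c n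
        = D.pt (D.vert v0 c n) := by
    rintro (_ | n)
    · rfl
    · exact congrArg D.pt (D.vert_congr v0 fun m hm => by simp [hm])
  simp only [hr]
  exact ⟨D.dist_vert v0 c, D.lt_dist_vert v0 c (fun _ => by simpa [hc0]) hc⟩

theorem not_copsWinWith (ht : 0 < t) (hε : 0 < ε) (v0 : V) (x0 : X) (h0 : ε < D.f v0 x0) {j : ℕ}
    (hj : j ≤ k) : ¬ CopsWinWith X (fun x y => dist x y) j := by
  intro H
  obtain ⟨σ, hσ⟩ := H (fun _ => t) ⟨fun _ => ht, fun h =>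
    ht.ne (tendsto_nhds_unique h.tendsto_atTop_zero tendsto_const_nhds)⟩
    (D.pt v0) (fun _ => x0)
  -- the positions of the `j` cops, completed by `k - j` idle ones
  let C : (ℕ → X) → ℕ → Fin k → X := fun r n i =>
    if hi : (i : ℕ) < j then copTraj (fun _ => x0) σ r n ⟨i, hi⟩ else x0
  have hC : ∀ {r r' : ℕ → X} {n : ℕ}, (∀ m ≤ n, r m = r' m) → C r n = C r' n := by
    intro r r' n h
    have : copTraj (fun _ => x0) σ r n = copTraj (fun _ => x0) σ r' n := by
      cases n with
      | zero => rfl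
      | succ n => exact congrArg (σ n) (funext fun i => h i (by omega))
    simp only [C, this]
  let w : ℕ → ℕ → V := fun n => Nat.rec (fun _ => v0)
    (fun n u => Function.update u (n + 1) (D.next (u n) (C (fun m => D.pt (u m)) n))) n
  have hw : ∀ n m, m ≤ n → w n m = w m m := by
    intro n
    induction n with
    | zero =>
      intro m hm
      rw [Nat.le_zero.1 hm]
    | succ n ih =>
      intro m hm
      rcases hm.eq_or_lt with rfl | hm
      · rfl
      · rw [← ih m (by omega)]
        exact Function.update_of_ne (by omega) _ _
  let r : ℕ → X := fun n => D.pt (w n n)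
  have hwv : ∀ n, w n n = D.vert v0 (C r) n := by
    intro n
    induction n with
    | zero => rfl
    | succ n ih =>
      rw [vert, ← ih]
      refine (Function.update_self ..).trans (congrArg (D.next (w n n)) (hC fun m hm => ?_))
      exact congrArg D.pt (hw n m hm)
  have hr : ∀ n, r n = D.pt (D.vert v0 (C r) n) := fun n => congrArg D.pt (hwv n)
  obtain ⟨hcop, hwin⟩ := hσ r (hr 0) fun n => by
    rw [hr n, hr (n + 1)]
    exact D.dist_vert v0 _ n
  obtain ⟨n, i, hni⟩ := hwin ε hε
  refine lt_asymm hni ?_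
  have := D.lt_dist_vert v0 (C r) (fun i => by simpa [C, copTraj] using h0) (fun n i => ?_) n
    (Fin.castLE hj i)
  · rw [← hr] at this
    simpa [C] using this
  · by_cases hi : (i : ℕ) < j
    · simpa [C, hi] using hcop n ⟨i, hi⟩
    · simpa [C, hi] using ht.le

theorem lt_copNumber (ht : 0 < t) (hε : 0 < ε) (v0 : V) (x0 : X) (h0 : ε < D.f v0 x0) :
    (k : ℕ∞) < copNumber X fun x y => dist x y := by
  rw [← ENat.add_one_le_iff (ENat.natCast_ne_top k)]
  refine le_sInf ?_
  rintro _ ⟨j, rfl, hj⟩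
  have : k < j := not_le.1 fun h => D.not_copsWinWith ht hε v0 x0 h0 h hj
  exact_mod_cast this

end EscapeData

open Classical in
/-- If `Z i` and `W j` measure how close a point is to the vertices `i` and `j` of a bipartite
graph with adjacency relation `R`, then `vertexGap R Z W i` is the truncated distance
in the graph to the vertex `i` when the point lies on an edge. -/
noncomputable def vertexGap {ι κ : Type*} [Fintype κ] (R : ι → κ → Prop) (Z : ι → ℝ) (W : κ → ℝ)
    (i : ι) : ℝ :=
  1 - Z i + max 0 (1 - 2 * Z i - ∑ j, if R i j then W j else 0)

section VertexGap

variable {ι κ : Type*} [Fintype κ] {R : ι → κ → Prop} {Z : ι → ℝ} {W : κ → ℝ}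

open Classical in
theorem vertexGap_single {i₀ : ι} {j₀ : κ} (hR : R i₀ j₀) {s : ℝ} (_ : 0 ≤ s) (_ : s ≤ 1)
    (i : ι) :
    vertexGap R (Pi.single i₀ (1 - s)) (Pi.single j₀ s) i =
      if i = i₀ then s else if R i j₀ then 2 - s else 2 := by
  have hsum : (∑ j, if R i j then Pi.single (M := fun _ => ℝ) j₀ s j else 0) =
      if R i j₀ then s else 0 := by
    rw [Finset.sum_eq_single j₀ (fun j _ hj => by simp [hj]) (by simp)]
    simp
  rw [vertexGap, hsum]
  by_cases hi : i = i₀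
  · subst hi
    simp only [Pi.single_eq_same, hR, if_true]
    rw [max_eq_left (by linarith)]
    ring
  · rw [Pi.single_eq_of_ne hi, if_neg hi]
    split_ifs
    · rw [max_eq_right (by linarith)]
      ring
    · norm_num

/-- In a bipartite graph without `4`-cycles, a point close to two neighbors of `i` is
close to `i`. -/
theorem vertexGap_le [Fintype ι] (hZ0 : ∀ i, 0 ≤ Z i) (hW0 : ∀ j, 0 ≤ W j)
    (hZW : ∀ i j, Z i + W j ≤ 1)
    (hZ : ∀ i i', 0 < Z i → 0 < Z i' → i = i') (hW : ∀ j j', 0 < W j → 0 < W j' → j = j')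
    (hR : ∀ i i' j j', R i j → R i j' → R i' j → R i' j' → i = i' ∨ j = j')
    {ε : ℝ} (hε : ε < 1 / 4) {i : ι} {j₁ j₂ : κ} (hne : j₁ ≠ j₂) (hi₁ : R i j₁) (hi₂ : R i j₂)
    (h₁ : vertexGap (flip R) W Z j₁ ≤ 1 + ε) (h₂ : vertexGap (flip R) W Z j₂ ≤ 1 + ε) :
    vertexGap R Z W i ≤ ε := by
  classical
  wlog hj : W j₁ = 0 generalizing j₁ j₂
  · refine this hne.symm hi₂ hi₁ h₂ h₁ ?_
    by_contra hj'
    exact hne (hW _ _ ((hW0 _).lt_of_ne' hj) ((hW0 _).lt_of_ne' hj'))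
  have bound : ∀ j, vertexGap (flip R) W Z j ≤ 1 + ε →
      1 - ε ≤ 3 * W j + ∑ a, if R a j then Z a else 0 := by
    intro j h
    replace h : 1 - W j + max 0 (1 - 2 * W j - ∑ a, if R a j then Z a else 0) ≤ 1 + ε := h
    linarith [le_max_right 0 (1 - 2 * W j - ∑ a, if R a j then Z a else 0)]
  have key : ∀ j, 1 - ε ≤ 3 * W j + ∑ a, (if R a j then Z a else 0) → 3 * W j < 1 - ε →
      ∃ a, R a j ∧ 1 - ε - 3 * W j ≤ Z a := by
    intro j h hj
    obtain ⟨a, -, ha⟩ := Finset.exists_ne_zero_of_sum_ne_zero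
      (show (∑ a, if R a j then Z a else 0) ≠ 0 by intro h0; linarith)
    have haR : R a j := by
      by_contra hn
      simp [hn] at ha
    rw [if_pos haR] at ha
    refine ⟨a, haR, ?_⟩
    rw [Finset.sum_eq_single a (fun b _ hb => ?_) (by simp), if_pos haR] at h
    · linarith
    · split_ifs
      · by_contra hb'
        exact hb (hZ _ _ ((hZ0 _).lt_of_ne' hb') ((hZ0 _).lt_of_ne' ha))
      · rfl
  obtain ⟨a, haR, ha⟩ := key j₁ (bound _ h₁) (by linarith)
  have hW₂ := hZW a j₂
  obtain ⟨b, hbR, hb⟩ := key j₂ (bound _ h₂) (by linarith)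
  obtain rfl : a = b := hZ _ _ (by linarith) (by linarith)
  obtain rfl : a = i := (hR a i j₁ j₂ haR hbR hi₁ hi₂).resolve_right hne
  have hsum : 0 ≤ ∑ j, if R a j then W j else 0 :=
    Finset.sum_nonneg fun j _ => by split_ifs <;> simp [hW0]
  rw [vertexGap, max_eq_left (by linarith)]
  linarith

end VertexGap

/-- A function supported on a narrow cone around the ray spanned by the unit vector `a`, and equal
to the norm on that ray. -/
noncomputable def coneBump (M : ℝ) (a z : ℂ) : ℝ := max 0 (‖z‖ - M * ‖z - ‖z‖ • a‖)

section ConeBump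

variable {M : ℝ} {a z : ℂ}

theorem coneBump_nonneg : 0 ≤ coneBump M a z := le_max_left _ _

theorem coneBump_le (hM : 0 ≤ M) : coneBump M a z ≤ ‖z‖ :=
  max_le (norm_nonneg _) (sub_le_self _ (mul_nonneg hM (norm_nonneg _)))

theorem eq_of_coneBump_pos {ι : Type*} {a : ι → ℂ} (hM0 : 0 ≤ M)
    (hM : ∀ i j, i ≠ j → 2 ≤ M * ‖a i - a j‖) {i j : ι}
    (hi : 0 < coneBump M (a i) z) (hj : 0 < coneBump M (a j) z) : i = j := by
  by_contra hne
  simp only [coneBump, lt_max_iff, lt_irrefl, false_or] at hi hj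
  have h := norm_sub_le (z - ‖z‖ • a j) (z - ‖z‖ • a i)
  rw [show z - ‖z‖ • a j - (z - ‖z‖ • a i) = ‖z‖ • (a i - a j) by rw [smul_sub]; ring, norm_smul,
    norm_norm] at h
  have h1 := mul_le_mul_of_nonneg_left h hM0
  have h2 := mul_le_mul_of_nonneg_left (hM i j hne) (norm_nonneg z)
  linarith

theorem coneBump_self {r : ℝ} (hr : 0 ≤ r) (ha : ‖a‖ = 1) : coneBump M a (r • a) = r := by
  simp [coneBump, ha, abs_of_nonneg hr, hr]

theorem coneBump_smul {ι : Type*} [DecidableEq ι] {a : ι → ℂ} (ha : ∀ i, ‖a i‖ = 1) (hM0 : 0 ≤ M)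
    (hM : ∀ i j, i ≠ j → 2 ≤ M * ‖a i - a j‖) {r : ℝ} (hr : 0 ≤ r) (i : ι) :
    (fun j => coneBump M (a j) (r • a i)) = Pi.single i r := by
  have hi := coneBump_self (M := M) hr (ha i)
  ext j
  by_cases hj : j = i
  · subst hj
    rw [Pi.single_eq_same]
    exact hi
  rw [Pi.single_eq_of_ne hj]
  by_contra h
  have h' : 0 < coneBump M (a j) (r • a i) := coneBump_nonneg.lt_of_ne' h
  have hr' : 0 < r := by
    have := coneBump_le (a := a j) (z := r • a i) hM0
    rw [norm_smul, ha, mul_one, Real.norm_of_nonneg hr] at this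
    linarith
  exact hj (eq_of_coneBump_pos hM0 hM h' (hi.symm ▸ hr'))

end ConeBump

/-- A compact space `S` whose nearby points are joined by short paths, mapped injectively to a
metric space `N` by a Lipschitz map `Ψ`, is homeomorphic to a game space whose distance dominates
the one pulled back by `Ψ`, and in which the paths that are short in `N` stay short. -/
theorem exists_gameSpace_of_lipschitz {S N : Type} [MetricSpace S] [CompactSpace S] [Nonempty S]
    [MetricSpace N] {Ψ : S → N} (hΨ : Function.Injective Ψ) {K : NNReal} (hK : LipschitzWith K Ψ)
    {g : S → S → ℝ} (hg0 : ∀ x y, 0 ≤ g x y) (hgt : ∀ x, Tendsto (g x) (𝓝 x) (𝓝 0))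
    (hg : ∀ x y, JoinedWithin x y (g x y)) :
    ∃ (X : Type) (_ : MetricSpace X) (e : X ≃ₜ S),
      GameSpaceD X (fun x y => dist x y) ∧
      (∀ x y, dist (Ψ (e x)) (Ψ (e y)) ≤ dist x y) ∧
      ∀ p : ℝ → S, IsShort (Ψ ∘ p) → IsShort (e.symm ∘ p) := by
  have hcpt : CompactSpace (Set.range Ψ) :=
    isCompact_iff_compactSpace.1 (isCompact_range hK.continuous)
  let E : S ≃ₜ Set.range Ψ := Continuous.homeoOfEquivCompactToT2
    (f := Equiv.ofInjective Ψ hΨ) (hK.continuous.subtype_mk _)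
  have hE : ∀ x, (E x : N) = Ψ x := fun x => rfl
  let K' : ℝ := K + 1
  have hK' : 0 < K' := by positivity
  have hdist : ∀ x y, dist (E x) (E y) ≤ K' * dist x y := fun x y =>
    (hK.dist_le_mul x y).trans (mul_le_mul_of_nonneg_right (by simp [K']) dist_nonneg)
  obtain ⟨X, _, e, h1, h2, h3⟩ := exists_intrinsic_metricSpace (Set.range Ψ)
    (fun x y => K' * g (E.symm x) (E.symm y)) (fun x y => mul_nonneg hK'.le (hg0 _ _))
    (fun x => by
      simpa using ((hgt (E.symm x)).comp (E.symm.continuous.tendsto x)).const_mul K')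
    (fun x y => by
      obtain ⟨p, hp, hp0, hp1⟩ := hg (E.symm x) (E.symm y)
      refine ⟨fun s => E (p (s / K')), fun s t => ?_, by simp [hp0], ?_⟩
      · refine (hdist _ _).trans ((mul_le_mul_of_nonneg_left (hp _ _) hK'.le).trans_eq ?_)
        rw [← sub_div, abs_div, abs_of_pos hK', mul_div_cancel₀ _ hK'.ne']
      · simp [mul_div_cancel_left₀ _ hK'.ne', hp1])
  have : CompactSpace X := e.symm.compactSpace
  have : Nonempty X := ‹Nonempty S›.map fun s => e.symm (E s)
  refine ⟨X, _, e.trans E.symm, gameSpaceD_of_short_paths h3, fun x y => ?_, fun p hp => ?_⟩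
  · have := h1 x y
    rwa [← E.apply_symm_apply (e x), ← E.apply_symm_apply (e y)] at this
  · exact h2 (E ∘ p) hp

/-- Two points of a sphere are joined by an arc of a great circle; an orthogonal direction is
provided for the case of antipodal points. -/
theorem joinedWithin_arccos {E : Type*} [NormedAddCommGroup E] [InnerProductSpace ℝ E]
    (h : ∀ x : E, ‖x‖ = 1 → ∃ u : E, ‖u‖ = 1 ∧ inner ℝ x u = 0) (x y : Metric.sphere (0 : E) 1) :
    JoinedWithin x y (Real.arccos (inner ℝ (x : E) (y : E))) := by
  obtain ⟨x, hx⟩ := x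
  obtain ⟨y, hy⟩ := y
  rw [mem_sphere_zero_iff_norm] at hx hy
  set θ := Real.arccos (inner ℝ x y)
  have hin := abs_le.1 ((abs_real_inner_le_norm x y).trans_eq (by rw [hx, hy, one_mul]))
  have hcos : Real.cos θ = inner ℝ x y := Real.cos_arccos hin.1 hin.2
  have hxx : inner ℝ x x = (1 : ℝ) := by rw [real_inner_self_eq_norm_sq, hx, one_pow]
  have hyy : inner ℝ y y = (1 : ℝ) := by rw [real_inner_self_eq_norm_sq, hy, one_pow]
  have hres : ‖y - Real.cos θ • x‖ ^ 2 = Real.sin θ ^ 2 := by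
    rw [← real_inner_self_eq_norm_sq, inner_sub_sub_self, Real.sin_sq]
    simp only [real_inner_smul_left, real_inner_smul_right, hxx, hyy, real_inner_comm x y, hcos]
    ring
  obtain ⟨u, hu, hxu, hyu⟩ : ∃ u : E, ‖u‖ = 1 ∧ inner ℝ x u = 0 ∧
      Real.cos θ • x + Real.sin θ • u = y := by
    by_cases hs : Real.sin θ = 0
    · obtain ⟨u, hu, hxu⟩ := h x hx
      refine ⟨u, hu, hxu, ?_⟩
      rw [hs, zero_pow two_ne_zero, sq_eq_zero_iff, norm_eq_zero, sub_eq_zero] at hres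
      rw [hs, zero_smul, add_zero, hres]
    · refine ⟨(Real.sin θ)⁻¹ • (y - Real.cos θ • x), ?_, ?_, ?_⟩
      · rw [norm_smul, ← sq_eq_sq₀ (by positivity) zero_le_one, mul_pow, hres, norm_inv, inv_pow,
          Real.norm_eq_abs, sq_abs, one_pow, inv_mul_cancel₀ (pow_ne_zero 2 hs)]
      · rw [real_inner_smul_right, inner_sub_right, real_inner_smul_right, hxx, hcos]
        ring
      · rw [smul_inv_smul₀ hs]
        abel
  have huu : inner ℝ u u = (1 : ℝ) := by rw [real_inner_self_eq_norm_sq, hu, one_pow]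
  have hux : inner ℝ u x = (0 : ℝ) := by rw [real_inner_comm, hxu]
  have hnorm : ∀ α β : ℝ, ‖α • x + β • u‖ ^ 2 = α ^ 2 + β ^ 2 := fun α β => by
    rw [← real_inner_self_eq_norm_sq]
    simp only [inner_add_left, inner_add_right, real_inner_smul_left, real_inner_smul_right, hxx,
      huu, hxu, hux]
    ring
  refine ⟨fun s => ⟨Real.cos s • x + Real.sin s • u, ?_⟩, fun s t => ?_, by simp, by simpa⟩
  · rw [mem_sphere_zero_iff_norm, ← sq_eq_sq₀ (norm_nonneg _) zero_le_one, hnorm,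
      Real.cos_sq_add_sin_sq, one_pow]
  · rw [Subtype.dist_eq, dist_eq_norm]
    refine abs_le_of_sq_le_sq' ?_ (abs_nonneg _) |>.2
    rw [show Real.cos s • x + Real.sin s • u - (Real.cos t • x + Real.sin t • u) =
      (Real.cos s - Real.cos t) • x + (Real.sin s - Real.sin t) • u by
        rw [sub_smul, sub_smul]; abel, hnorm, sq_abs]
    have h1 := Real.one_sub_sq_div_two_le_cos (x := s - t)
    rw [Real.cos_sub] at h1
    nlinarith [Real.sin_sq_add_cos_sq s, Real.sin_sq_add_cos_sq t]

/-- A Lipschitz map, with unspecified constant. -/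
def IsLipschitz {α β : Type*} [PseudoEMetricSpace α] [PseudoEMetricSpace β] (f : α → β) : Prop :=
  ∃ K, LipschitzWith K f

namespace IsLipschitz

variable {α β γ : Type*} [PseudoEMetricSpace α]

theorem of_dist_le {α β : Type*} [PseudoMetricSpace α] [PseudoMetricSpace β] {f : α → β}
    (K : NNReal) (h : ∀ x y, dist (f x) (f y) ≤ K * dist x y) : IsLipschitz f :=
  ⟨K, .of_dist_le_mul h⟩

theorem comp [PseudoEMetricSpace β] [PseudoEMetricSpace γ] {f : β → γ} {g : α → β}
    (hf : IsLipschitz f) (hg : IsLipschitz g) : IsLipschitz (f ∘ g) :=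
  ⟨_, hf.choose_spec.comp hg.choose_spec⟩

theorem prodMk [PseudoEMetricSpace β] [PseudoEMetricSpace γ] {f : α → β} {g : α → γ}
    (hf : IsLipschitz f) (hg : IsLipschitz g) : IsLipschitz fun x => (f x, g x) :=
  ⟨_, hf.choose_spec.prodMk hg.choose_spec⟩

theorem pi {ι : Type*} [Fintype ι] [PseudoEMetricSpace β] {f : α → ι → β}
    (hf : ∀ i, IsLipschitz fun x => f x i) : IsLipschitz f := by
  choose K hK using hf
  refine ⟨∑ i, K i, fun x y => edist_pi_le_iff.2 fun i => (hK i x y).trans ?_⟩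
  gcongr
  exact Finset.single_le_sum (f := K) (fun _ _ => zero_le) (Finset.mem_univ i)

variable {E : Type*} [SeminormedAddCommGroup E] {f g : α → E}

theorem const (c : E) : IsLipschitz fun _ : α => c := ⟨0, .const c⟩

theorem sub (hf : IsLipschitz f) (hg : IsLipschitz g) : IsLipschitz fun x => f x - g x :=
  ⟨_, hf.choose_spec.sub hg.choose_spec⟩

theorem add (hf : IsLipschitz f) (hg : IsLipschitz g) : IsLipschitz fun x => f x + g x :=
  ⟨_, hf.choose_spec.add hg.choose_spec⟩

theorem sum {ι : Type*} {s : Finset ι} {f : ι → α → E} (hf : ∀ i, IsLipschitz (f i)) :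
    IsLipschitz fun x => ∑ i ∈ s, f i x := by
  classical
  induction s using Finset.induction_on with
  | empty => simpa using const 0
  | insert i s hi ih => simpa [Finset.sum_insert hi] using (hf i).add ih

theorem norm (hf : IsLipschitz f) : IsLipschitz fun x => ‖f x‖ :=
  .comp ⟨_, lipschitzWith_one_norm⟩ hf

theorem smul_const [NormedSpace ℝ E] {f : α → ℝ} (hf : IsLipschitz f) (a : E) :
    IsLipschitz fun x => f x • a :=
  .comp ⟨_, (ContinuousLinearMap.toSpanSingleton ℝ a).lipschitz⟩ hf

theorem const_mul {f : α → ℝ} (hf : IsLipschitz f) (a : ℝ) : IsLipschitz fun x => a * f x := by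
  simpa [mul_comm] using hf.smul_const a

theorem const_max {f : α → ℝ} (hf : IsLipschitz f) (a : ℝ) : IsLipschitz fun x => max a (f x) :=
  ⟨_, hf.choose_spec.const_max a⟩

theorem coneBump {f : α → ℂ} (hf : IsLipschitz f) (M : ℝ) (a : ℂ) :
    IsLipschitz fun x => coneBump M a (f x) :=
  (hf.norm.sub ((hf.sub (hf.norm.smul_const a)).norm.const_mul M)).const_max 0

theorem vertexGap {ι κ : Type*} [Fintype κ] (R : ι → κ → Prop) {Z : α → ι → ℝ} {W : α → κ → ℝ}
    (hZ : ∀ i, IsLipschitz fun x => Z x i) (hW : ∀ j, IsLipschitz fun x => W x j) (i : ι) :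
    IsLipschitz fun x => vertexGap R (Z x) (W x) i := by
  refine ((const 1).sub (hZ i)).add (IsLipschitz.const_max (((const 1).sub
    ((hZ i).const_mul 2)).sub (sum fun j => ?_)) 0)
  split_ifs
  · exact hW j
  · exact const 0

end IsLipschitz

section Sphere

/-- The first two coordinates of a point of `ℝ⁴`, as a complex number. -/
def planeFst (x : EuclideanSpace ℝ (Fin 4)) : ℂ := ⟨x 0, x 1⟩

/-- The last two coordinates of a point of `ℝ⁴`, as a complex number. -/
def planeSnd (x : EuclideanSpace ℝ (Fin 4)) : ℂ := ⟨x 2, x 3⟩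

theorem norm_sq_planes (x : EuclideanSpace ℝ (Fin 4)) :
    ‖planeFst x‖ ^ 2 + ‖planeSnd x‖ ^ 2 = ‖x‖ ^ 2 := by
  rw [EuclideanSpace.norm_sq_eq, Fin.sum_univ_four, Complex.sq_norm, Complex.sq_norm]
  simp only [planeFst, planeSnd, Complex.normSq_mk, Real.norm_eq_abs, sq_abs]
  ring

theorem planeFst_sub (x y : EuclideanSpace ℝ (Fin 4)) :
    planeFst (x - y) = planeFst x - planeFst y := by
  apply Complex.ext <;> simp [planeFst]

theorem planeSnd_sub (x y : EuclideanSpace ℝ (Fin 4)) :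
    planeSnd (x - y) = planeSnd x - planeSnd y := by
  apply Complex.ext <;> simp [planeSnd]

theorem norm_planeFst_le (x : EuclideanSpace ℝ (Fin 4)) : ‖planeFst x‖ ≤ ‖x‖ := by
  refine le_of_sq_le_sq ?_ (norm_nonneg x)
  nlinarith [norm_sq_planes x]

theorem norm_planeSnd_le (x : EuclideanSpace ℝ (Fin 4)) : ‖planeSnd x‖ ≤ ‖x‖ := by
  refine le_of_sq_le_sq ?_ (norm_nonneg x)
  nlinarith [norm_sq_planes x]

theorem norm_norm_smul_sub_le {E : Type*} [NormedAddCommGroup E] [NormedSpace ℝ E] {z w : E}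
    (hz : ‖z‖ ≤ 1) (hw : ‖w‖ ≤ 1) : ‖‖z‖ • z - ‖w‖ • w‖ ≤ 2 * ‖z - w‖ := by
  rw [show ‖z‖ • z - ‖w‖ • w = ‖z‖ • (z - w) + (‖z‖ - ‖w‖) • w by
    rw [smul_sub, sub_smul]; abel]
  refine (norm_add_le _ _).trans ?_
  rw [norm_smul, norm_smul, norm_norm, Real.norm_eq_abs]
  nlinarith [abs_norm_sub_norm_le z w, abs_nonneg (‖z‖ - ‖w‖), norm_nonneg (z - w), norm_nonneg w]

theorem norm_smul_injective {E : Type*} [NormedAddCommGroup E] [NormedSpace ℝ E] :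
    Function.Injective fun z : E => ‖z‖ • z := by
  intro z w h
  have hn : ‖z‖ = ‖w‖ := by
    have := congrArg norm h
    simp only [norm_smul, norm_norm] at this
    nlinarith [norm_nonneg z, norm_nonneg w]
  rcases eq_or_ne ‖w‖ 0 with h0 | h0
  · rw [norm_eq_zero.1 h0, norm_eq_zero.1 (hn.trans h0)]
  · simp only [hn] at h
    exact smul_right_injective E h0 h

/-- The coordinates of a point of the `3`-sphere seen as the join of two circles. -/
noncomputable def joinCoord (x : Metric.sphere (0 : EuclideanSpace ℝ (Fin 4)) 1) : ℂ × ℂ :=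
  (‖planeFst x‖ • planeFst x, ‖planeSnd x‖ • planeSnd x)

theorem norm_joinCoord (x : Metric.sphere (0 : EuclideanSpace ℝ (Fin 4)) 1) :
    ‖(joinCoord x).1‖ + ‖(joinCoord x).2‖ = 1 := by
  have h := norm_sq_planes x
  rw [mem_sphere_zero_iff_norm.1 x.2, one_pow] at h
  simpa only [joinCoord, norm_smul, norm_norm, ← sq] using h

theorem joinCoord_injective : Function.Injective joinCoord := by
  intro x y h
  obtain ⟨h1, h2⟩ := Prod.ext_iff.1 h
  replace h1 := norm_smul_injective h1
  replace h2 := norm_smul_injective h2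
  simp only [planeFst, planeSnd, Complex.mk.injEq] at h1 h2
  ext i
  fin_cases i
  exacts [h1.1, h1.2, h2.1, h2.2]

theorem exists_joinCoord_eq {q : ℂ × ℂ} (hq : ‖q.1‖ + ‖q.2‖ = 1) : ∃ x, joinCoord x = q := by
  have key : ∀ z : ℂ, ∃ w : ℂ, ‖w‖ ^ 2 = ‖z‖ ∧ ‖w‖ • w = z := fun z => by
    have h0 : ‖(√‖z‖)⁻¹ • z‖ = √‖z‖ := by
      rw [norm_smul, norm_inv, Real.norm_of_nonneg (Real.sqrt_nonneg _), inv_mul_eq_div,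
        Real.div_sqrt]
    refine ⟨(√‖z‖)⁻¹ • z, by rw [h0, Real.sq_sqrt (norm_nonneg _)], ?_⟩
    rw [h0]
    rcases eq_or_ne z 0 with rfl | hz
    · simp
    · exact smul_inv_smul₀ (by simpa [Real.sqrt_eq_zero] using hz) z
  obtain ⟨w, hw, hw'⟩ := key q.1
  obtain ⟨v, hv, hv'⟩ := key q.2
  refine ⟨⟨!₂[w.re, w.im, v.re, v.im], ?_⟩, Prod.ext hw' hv'⟩
  rw [mem_sphere_zero_iff_norm, ← sq_eq_sq₀ (norm_nonneg _) zero_le_one, ← norm_sq_planes]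
  simpa [hw, hv, planeFst, planeSnd] using hq

theorem isLipschitz_joinCoord : IsLipschitz joinCoord := by
  have hle : ∀ x : Metric.sphere (0 : EuclideanSpace ℝ (Fin 4)) 1,
      ‖planeFst x‖ ≤ 1 ∧ ‖planeSnd x‖ ≤ 1 := fun x =>
    have hx := (mem_sphere_zero_iff_norm.1 x.2).le
    ⟨(norm_planeFst_le _).trans hx, (norm_planeSnd_le _).trans hx⟩
  refine .of_dist_le 2 fun x y => max_le ?_ ?_ <;>
    rw [dist_eq_norm, Subtype.dist_eq, dist_eq_norm, NNReal.coe_ofNat]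
  · refine (norm_norm_smul_sub_le (hle x).1 (hle y).1).trans ?_
    rw [← planeFst_sub]
    gcongr
    exact norm_planeFst_le _
  · refine (norm_norm_smul_sub_le (hle x).2 (hle y).2).trans ?_
    rw [← planeSnd_sub]
    gcongr
    exact norm_planeSnd_le _

theorem exists_orthogonal (x : EuclideanSpace ℝ (Fin 4)) (hx : ‖x‖ = 1) :
    ∃ u : EuclideanSpace ℝ (Fin 4), ‖u‖ = 1 ∧ inner ℝ x u = 0 := by
  refine ⟨!₂[-x 1, x 0, -x 3, x 2], ?_, ?_⟩
  · rw [← hx, ← sq_eq_sq₀ (norm_nonneg _) (norm_nonneg _), EuclideanSpace.norm_sq_eq,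
      EuclideanSpace.norm_sq_eq, Fin.sum_univ_four, Fin.sum_univ_four]
    simp
    ring
  · rw [PiLp.inner_apply, Fin.sum_univ_four]
    simp
    ring

/-- Lipschitz functions of the join coordinates of the `3`-sphere can be made to change with speed
at most `1`, while the curves along which they already do so remain short. -/
theorem exists_gameSpace_sphere {V : Type} [Fintype V] {F : V → ℂ × ℂ → ℝ}
    (hF : ∀ v, IsLipschitz (F v)) :
    ∃ (X : Type) (_ : MetricSpace X) (e : X ≃ₜ Metric.sphere (0 : EuclideanSpace ℝ (Fin 4)) 1),
      GameSpaceD X (fun x y => dist x y) ∧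
      (∀ v x y, F v (joinCoord (e x)) ≤ F v (joinCoord (e y)) + dist x y) ∧
      ∀ p : ℝ → Metric.sphere (0 : EuclideanSpace ℝ (Fin 4)) 1, IsShort (joinCoord ∘ p) →
        (∀ v, IsShort (F v ∘ joinCoord ∘ p)) → IsShort (e.symm ∘ p) := by
  have hg : ∀ x : Metric.sphere (0 : EuclideanSpace ℝ (Fin 4)) 1, Tendsto
      (fun y : Metric.sphere (0 : EuclideanSpace ℝ (Fin 4)) 1 =>
        Real.arccos (inner ℝ (x : EuclideanSpace ℝ (Fin 4)) y)) (𝓝 x) (𝓝 0) := fun x => by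
    have h : Continuous fun y : Metric.sphere (0 : EuclideanSpace ℝ (Fin 4)) 1 =>
        Real.arccos (inner ℝ (x : EuclideanSpace ℝ (Fin 4)) y) :=
      Real.continuous_arccos.comp (continuous_const.inner continuous_subtype_val)
    simpa [real_inner_self_eq_norm_sq] using h.tendsto x
  obtain ⟨K, hK⟩ : IsLipschitz fun x => (joinCoord x, fun v => F v (joinCoord x)) :=
    isLipschitz_joinCoord.prodMk (.pi fun v => (hF v).comp isLipschitz_joinCoord)
  have : Nonempty (Metric.sphere (0 : EuclideanSpace ℝ (Fin 4)) 1) :=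
    (NormedSpace.sphere_nonempty.2 zero_le_one).to_subtype
  obtain ⟨X, _, e, h1, h2, h3⟩ := exists_gameSpace_of_lipschitz
    (fun x y h => joinCoord_injective (congrArg Prod.fst h)) hK
    (fun x y => Real.arccos_nonneg _) hg (joinedWithin_arccos exists_orthogonal)
  refine ⟨X, _, e, h1, fun v x y => ?_, fun p hp hpF => h3 p fun s t => ?_⟩
  · have := (dist_pi_le_iff dist_nonneg).1 ((le_max_right _ _).trans (h2 x y)) v
    rw [Real.dist_eq] at this
    linarith [le_abs_self (F v (joinCoord (e x)) - F v (joinCoord (e y)))]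
  · exact max_le (hp s t) ((dist_pi_le_iff (abs_nonneg _)).2 fun v => hpF v s t)

end Sphere

/-- For finitely many indices there are distinct unit complex numbers, and they are separated by
a positive amount. -/
theorem exists_separated_units (ι : Type*) [Fintype ι] :
    ∃ (a : ι → ℂ) (M : ℝ), 0 ≤ M ∧ (∀ i, ‖a i‖ = 1) ∧ ∀ i j, i ≠ j → 2 ≤ M * ‖a i - a j‖ := by
  obtain ⟨a, ha, hinj⟩ : ∃ a : ι → ℂ, (∀ i, ‖a i‖ = 1) ∧ Function.Injective a := by
    have hζ := Complex.isPrimitiveRoot_exp (Fintype.card ι + 1) (Nat.succ_ne_zero _)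
    refine ⟨fun i => Complex.exp (2 * Real.pi * Complex.I / (Fintype.card ι + 1 : ℕ)) ^
      (Fintype.equivFin ι i : ℕ), fun i => ?_, fun i j h => ?_⟩
    · rw [norm_pow, hζ.norm'_eq_one (Nat.succ_ne_zero _), one_pow]
    · exact (Fintype.equivFin ι).injective (Fin.ext (hζ.pow_inj (by omega) (by omega) h))
  refine ⟨a, ∑ x : ι × ι, 2 / ‖a x.1 - a x.2‖, Finset.sum_nonneg fun _ _ => by positivity, ha,
    fun i j hij => ?_⟩
  have hpos : 0 < ‖a i - a j‖ := norm_pos_iff.2 (sub_ne_zero.2 (hinj.ne hij))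
  rw [← div_le_iff₀ hpos]
  exact Finset.single_le_sum (f := fun x : ι × ι => 2 / ‖a x.1 - a x.2‖)
    (fun _ _ => by positivity) (Finset.mem_univ (i, j))

/-- A bipartite graph without `4`-cycles in which every vertex has more than `k` neighbors gives
rise to a geodesic `3`-sphere on which `k` cops cannot catch a robber walking along the graph. -/
theorem exists_sphere3_of_graph {ι κ : Type} [Fintype ι] [Fintype κ] {k : ℕ} {R : ι → κ → Prop}
    (hR : ∀ i i' j j', R i j → R i j' → R i' j → R i' j' → i = i' ∨ j = j')
    (nι : ι → Fin (k + 1) → κ) (hnι : ∀ i, Function.Injective (nι i)) (hRι : ∀ i s, R i (nι i s))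
    (nκ : κ → Fin (k + 1) → ι) (hnκ : ∀ j, Function.Injective (nκ j)) (hRκ : ∀ j s, R (nκ j s) j)
    (i₀ : ι) :
    ∃ (X : Type) (_ : MetricSpace X),
      GameSpaceD X (fun x y => dist x y) ∧
      Nonempty (X ≃ₜ ↥(Metric.sphere (0 : EuclideanSpace ℝ (Fin 4)) 1)) ∧
      (k : ℕ∞) < copNumber X (fun x y => dist x y) ∧
      ∃ t ε : ℝ, 0 < t ∧ 0 < ε ∧
        RobberWins X (fun x y => dist x y) k (fun _ => t) ε := by
  classical
  obtain ⟨a, M, hM0, ha, hM⟩ := exists_separated_units ι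
  obtain ⟨b, N, hN0, hb, hN⟩ := exists_separated_units κ
  let Z : ℂ × ℂ → ι → ℝ := fun q i => coneBump M (a i) q.1
  let W : ℂ × ℂ → κ → ℝ := fun q j => coneBump N (b j) q.2
  let F : ι ⊕ κ → ℂ × ℂ → ℝ := Sum.elim (fun i q => vertexGap R (Z q) (W q) i)
    fun j q => vertexGap (flip R) (W q) (Z q) j
  have hZL : ∀ i, IsLipschitz fun q => Z q i := fun i =>
    .coneBump ⟨_, LipschitzWith.prod_fst⟩ _ _
  have hWL : ∀ j, IsLipschitz fun q => W q j := fun j =>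
    .coneBump ⟨_, LipschitzWith.prod_snd⟩ _ _
  obtain ⟨X, _, e, hX, hFle, hshort⟩ := exists_gameSpace_sphere (F := F) (by
    rintro (i | j)
    · exact .vertexGap R hZL hWL i
    · exact .vertexGap (flip R) hWL hZL j)
  have hinv : ∀ q : ℂ × ℂ, ∃ x, ‖q.1‖ + ‖q.2‖ = 1 → joinCoord x = q := fun q => by
    by_cases hq : ‖q.1‖ + ‖q.2‖ = 1
    · obtain ⟨x, hx⟩ := exists_joinCoord_eq hq
      exact ⟨x, fun _ => hx⟩
    · exact ⟨e hX.1.some, fun h => absurd h hq⟩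
  choose G hG using hinv
  let edge : ι → κ → ℝ → ℂ × ℂ := fun i j s => ((1 - s) • a i, s • b j)
  have hZedge : ∀ i j s, s ≤ 1 → Z (edge i j s) = Pi.single i (1 - s) := fun i j s hs =>
    coneBump_smul ha hM0 hM (sub_nonneg.2 hs) i
  have hWedge : ∀ i j s, 0 ≤ s → W (edge i j s) = Pi.single j s := fun i j s hs =>
    coneBump_smul hb hN0 hN hs j
  have hFι : ∀ i j, R i j → ∀ s, 0 ≤ s → s ≤ 1 → ∀ i',
      F (.inl i') (edge i j s) = if i' = i then s else if R i' j then 2 - s else 2 := by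
    intro i j hij s hs0 hs1 i'
    simp only [F, Sum.elim_inl]
    rw [hZedge i j s hs1, hWedge i j s hs0]
    exact vertexGap_single hij hs0 hs1 i'
  have hFκ : ∀ i j, R i j → ∀ s, 0 ≤ s → s ≤ 1 → ∀ j',
      F (.inr j') (edge i j s) = if j' = j then 1 - s else if R i j' then 1 + s else 2 := by
    intro i j hij s hs0 hs1 j'
    have h := vertexGap_single (R := flip R) (i₀ := j) (j₀ := i) hij (sub_nonneg.2 hs1)
      (sub_le_self 1 hs0) j'
    rw [sub_sub_cancel] at h
    simp only [F, Sum.elim_inr]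
    rw [hZedge i j s hs1, hWedge i j s hs0, h, show 2 - (1 - s) = 1 + s by ring]
    rfl
  have hGedge : ∀ i j s, 0 ≤ s → s ≤ 1 → joinCoord (G (edge i j s)) = edge i j s := by
    intro i j s hs0 hs1
    refine hG _ ?_
    simp only [edge]
    rw [norm_smul, norm_smul, ha, hb, Real.norm_of_nonneg hs0,
      Real.norm_of_nonneg (sub_nonneg.2 hs1)]
    ring
  let pt : ι ⊕ κ → X := fun v => e.symm (G (Sum.elim (fun i => (a i, 0)) (fun j => (0, b j)) v))
  have hpt0 : ∀ i j, pt (.inl i) = e.symm (G (edge i j 0)) := fun i j => by simp [pt, edge]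
  have hpt1 : ∀ i j, pt (.inr j) = e.symm (G (edge i j 1)) := fun i j => by simp [pt, edge]
  have hadj : ∀ i j, R i j → dist (pt (.inl i)) (pt (.inr j)) ≤ 1 := by
    intro i j hij
    let c : ℝ → ℝ := fun s => max 0 (min 1 s)
    have hc0 : ∀ s, 0 ≤ c s := fun s => le_max_left _ _
    have hc1 : ∀ s, c s ≤ 1 := fun s => max_le zero_le_one (min_le_left _ _)
    have hc : ∀ s t, |c s - c t| ≤ |s - t| := fun s t =>
      ((LipschitzWith.id.const_min 1).const_max 0).dist_le_mul s t |>.trans_eq (by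
        simp [Real.dist_eq])
    have hpath := hshort (fun s => G (edge i j (c s))) (fun s t => ?_) (fun v s t => ?_)
    · rw [hpt0 i j, hpt1 i j]
      simpa [c] using hpath 0 1
    · simp only [Function.comp, hGedge i j _ (hc0 _) (hc1 _)]
      refine max_le ?_ ?_ <;> simp only [edge] <;>
        rw [dist_eq_norm, ← sub_smul, norm_smul, Real.norm_eq_abs]
      · rw [ha, mul_one, sub_sub_sub_cancel_left, abs_sub_comm]
        exact hc s t
      · rw [hb, mul_one]
        exact hc s t
    · simp only [Function.comp, hGedge i j _ (hc0 _) (hc1 _)]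
      refine le_trans ?_ (hc s t)
      rw [Real.dist_eq]
      rcases v with i' | j'
      · rw [hFι i j hij _ (hc0 s) (hc1 s), hFι i j hij _ (hc0 t) (hc1 t)]
        split_ifs
        · exact le_rfl
        · rw [sub_sub_sub_cancel_left, abs_sub_comm]
        · simp
      · rw [hFκ i j hij _ (hc0 s) (hc1 s), hFκ i j hij _ (hc0 t) (hc1 t)]
        split_ifs
        · rw [sub_sub_sub_cancel_left, abs_sub_comm]
        · rw [add_sub_add_left_eq_sub]
        · simp
  have hZW : ∀ x i j, Z (joinCoord x) i + W (joinCoord x) j ≤ 1 := fun x i j =>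
    (add_le_add (coneBump_le hM0) (coneBump_le hN0)).trans_eq (norm_joinCoord x)
  let D : EscapeData X (ι ⊕ κ) k 1 (1 / 8) :=
    { pt := pt
      f := fun v x => F v (joinCoord (e x))
      nb := Sum.elim (fun i s => .inr (nι i s)) fun j s => .inl (nκ j s)
      f_pt := by
        rintro (i | j)
        · rw [hpt0 i (nι i 0), e.apply_symm_apply, hGedge _ _ _ le_rfl zero_le_one,
            hFι _ _ (hRι i 0) _ le_rfl zero_le_one, if_pos rfl]
        · rw [hpt1 (nκ j 0) j, e.apply_symm_apply, hGedge _ _ _ zero_le_one le_rfl,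
            hFκ _ _ (hRκ j 0) _ zero_le_one le_rfl, if_pos rfl, sub_self]
      f_le := hFle
      dist_nb := by
        rintro (i | j) s
        · exact hadj _ _ (hRι i s)
        · rw [dist_comm]
          exact hadj _ _ (hRκ j s)
      close := by
        rintro (i | j) x s t hst hs ht
        · exact vertexGap_le (fun _ => coneBump_nonneg) (fun _ => coneBump_nonneg) (hZW _)
            (fun _ _ => eq_of_coneBump_pos hM0 hM) (fun _ _ => eq_of_coneBump_pos hN0 hN) hR
            (by norm_num) ((hnι i).ne hst) (hRι i s) (hRι i t) hs ht
        · exact vertexGap_le (R := flip R) (fun _ => coneBump_nonneg) (fun _ => coneBump_nonneg)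
            (fun j i => (add_comm _ _).trans_le (hZW _ i j))
            (fun _ _ => eq_of_coneBump_pos hN0 hN) (fun _ _ => eq_of_coneBump_pos hM0 hM)
            (fun j j' i i' h1 h2 h3 h4 => (hR i i' j j' h1 h3 h2 h4).symm)
            (by norm_num) ((hnκ j).ne hst) (hRκ j s) (hRκ j t) hs ht }
  have h0 : 1 / 8 < D.f (.inl i₀) (pt (.inr (nι i₀ 0))) := by
    have : D.f (.inl i₀) (pt (.inr (nι i₀ 0))) = 1 := by
      simp only [D]
      rw [hpt1 i₀ (nι i₀ 0), e.apply_symm_apply, hGedge _ _ _ zero_le_one le_rfl,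
        hFι _ _ (hRι i₀ 0) _ zero_le_one le_rfl, if_pos rfl]
    rw [this]
    norm_num
  exact ⟨X, _, hX, ⟨e⟩, D.lt_copNumber one_pos (by norm_num) _ _ h0, 1, 1 / 8, one_pos,
    by norm_num, D.robberWins _ _ h0⟩

/-- Counterexample 2 of the paper. For every `k` there is a game space
`(X,d)` homeomorphic to the `3`-sphere with cop number `> k`; moreover the robber has a
strategy against `k` cops using a constant agility function keeping all cops at distance
bounded away from `0`. -/
theorem exists_sphere3_large_cop_number (k : ℕ) :
    ∃ (X : Type) (_ : MetricSpace X),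
      GameSpaceD X (fun x y => dist x y) ∧
      Nonempty (X ≃ₜ ↥(Metric.sphere (0 : EuclideanSpace ℝ (Fin 4)) 1)) ∧
      (k : ℕ∞) < copNumber X (fun x y => dist x y) ∧
      ∃ t ε : ℝ, 0 < t ∧ 0 < ε ∧
        RobberWins X (fun x y => dist x y) k (fun _ => t) ε := by
  obtain ⟨p, hkp, hp⟩ := Nat.exists_infinite_primes (k + 1)
  have : Fact p.Prime := ⟨hp⟩
  let c : Fin (k + 1) → ZMod p := fun s => ((s : ℕ) : ZMod p)
  have hc : Function.Injective c := fun s t h => Fin.ext (by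
    simpa [Nat.mod_eq_of_lt (s.2.trans_le hkp), Nat.mod_eq_of_lt (t.2.trans_le hkp), Nat.ModEq]
      using (ZMod.natCast_eq_natCast_iff _ _ _).1 h)
  -- points `(x, y)` and lines `y = m * x + b` of the affine plane
  refine exists_sphere3_of_graph (ι := ZMod p × ZMod p) (κ := ZMod p × ZMod p)
    (R := fun i j => i.2 = j.1 * i.1 + j.2) ?_
    (fun i s => (c s, i.2 - c s * i.1)) (fun i s t h => hc (congrArg Prod.fst h))
    (fun i s => by ring)
    (fun j s => (c s, j.1 * c s + j.2)) (fun j s t h => hc (congrArg Prod.fst h))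
    (fun j s => rfl) 0
  rintro ⟨x, y⟩ ⟨x', y'⟩ ⟨m, b⟩ ⟨m', b'⟩ h1 h2 h3 h4
  dsimp only at h1 h2 h3 h4
  have h : (m - m') * (x - x') = 0 := by linear_combination h2 - h1 + h3 - h4
  rcases mul_eq_zero.1 h with h | h
  · obtain rfl := sub_eq_zero.1 h
    exact Or.inr (Prod.ext rfl (by linear_combination h2 - h1))
  · obtain rfl := sub_eq_zero.1 h
    exact Or.inl (Prod.ext rfl (h1.trans h3.symm))
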